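/- arXiv:2207.09806 — 2 statements merged into one kernel-verified Lean document; each statement's English description precedes it below -/
import Mathlib

section
/- Let n, k and r be integers with 1 < r < k < n. Then ⌊(rn-1)/k⌋ - 1 ≤ σ(n,k,r) ≤ ⌊(rn-1)/k⌋, where σ(n,k,r) is the largest value of s ∈ [0,n] such that an (s,k,r)-clash-free permutation of Z_n exists. -/
/-- `cyclNorm n X` is the minimum length of a cyclic interval of `ZMod n`
containing `X`: the least `t` such that `X ⊆ x + [0,t] (mod n)` for some `x`. -/
noncomputable def cyclNorm (n : ℕ) (X : Set (ZMod n)) : ℕ :=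
  sInf {t : ℕ | ∃ x : ZMod n, ∀ y ∈ X, ∃ i : ℕ, i ≤ t ∧ y = x + (i : ZMod n)}

/-- A permutation `π` of `ZMod n` is `(s,k,r)`-clash-free if there is no
`(r+1)`-subset `X` with `‖X‖ < s` and `‖π(X)‖ < k`. -/
def IsClashFreeR (n s k r : ℕ) (π : Equiv.Perm (ZMod n)) : Prop :=
  ¬ ∃ X : Finset (ZMod n), X.card = r + 1 ∧
      cyclNorm n (X : Set (ZMod n)) < s ∧
      cyclNorm n (⇑π '' (X : Set (ZMod n))) < k

/-- `sigmaR n k r` is the largest `s ∈ [0,n]` such that an `(s,k,r)`-clash-free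
permutation of `ZMod n` exists. -/
noncomputable def sigmaR (n k r : ℕ) : ℕ :=
  sSup {s : ℕ | s ≤ n ∧ ∃ π : Equiv.Perm (ZMod n), IsClashFreeR n s k r π}

theorem cyclNorm_lt_iff (n : ℕ) [NeZero n] (X : Set (ZMod n)) (s : ℕ) :
    cyclNorm n X < s → ∃ x : ZMod n, ∀ y ∈ X, ∃ i : ℕ, i < s ∧ y = x + (i : ZMod n) := by
  intro h
  have hne : {t : ℕ | ∃ x : ZMod n, ∀ y ∈ X, ∃ i : ℕ, i ≤ t ∧ y = x + (i : ZMod n)}.Nonempty := by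
    refine ⟨n, 0, fun y _ => ⟨y.val, (ZMod.val_lt y).le, by simp⟩⟩
  obtain ⟨x, hx⟩ := Nat.sInf_mem hne
  refine ⟨x, fun y hy => ?_⟩
  obtain ⟨i, hi, e⟩ := hx y hy
  exact ⟨i, lt_of_le_of_lt hi h, e⟩

theorem cyclNorm_lt_of (n : ℕ) (X : Set (ZMod n)) (s : ℕ) (hs : 0 < s) (x : ZMod n)
    (h : ∀ y ∈ X, ∃ i : ℕ, i < s ∧ y = x + (i : ZMod n)) : cyclNorm n X < s := by
  have : cyclNorm n X ≤ s - 1 := by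
    apply Nat.sInf_le
    refine ⟨x, fun y hy => ?_⟩
    obtain ⟨i, hi, e⟩ := h y hy
    exact ⟨i, by omega, e⟩
  omega

theorem natCast_inj_of_lt (n i j : ℕ) (hi : i < n) (hj : j < n)
    (h : (i : ZMod n) = (j : ZMod n)) : i = j := by
  rw [ZMod.natCast_eq_natCast_iff] at h
  exact Nat.ModEq.eq_of_lt_of_lt h hi hj

open Classical in
theorem upper_aux (n k r s : ℕ) (hr : 1 < r) (hrk : r < k) (hkn : k < n)
    (π : Equiv.Perm (ZMod n)) (h : IsClashFreeR n s k r π) : s ≤ n → s * k < r * n := by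
  intro hsn
  haveI : NeZero n := ⟨by omega⟩
  rcases Nat.eq_zero_or_pos s with rfl | hs
  · rw [zero_mul]; exact Nat.mul_pos (by omega) (by omega)
  let P : ZMod n → ZMod n → Prop := fun x y => ∃ i : ℕ, i < s ∧ π.symm y = x + (i : ZMod n)
  let g : ZMod n → ZMod n → ℕ := fun x y => if P x y then 1 else 0
  let f : ZMod n → ZMod n → ℕ := fun x y => ∑ i ∈ Finset.range k, g x (y + (i : ZMod n))
  have hf : ∀ x y, f x y ≤ r := by
    intro x y
    by_contra hc
    push Not at hc
    have hcard : r + 1 ≤ ((Finset.range k).filter (fun i : ℕ => P x (y + (i : ZMod n)))).card := by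
      rw [Finset.card_filter]; exact hc
    obtain ⟨I, hI, hIc⟩ := Finset.exists_subset_card_eq hcard
    have hI' : ∀ i ∈ I, i < k ∧ P x (y + (i : ZMod n)) := by
      intro i hi
      have := hI hi
      simpa using this
    apply h
    refine ⟨I.image (fun i : ℕ => π.symm (y + (i : ZMod n))), ?_, ?_, ?_⟩
    · rw [Finset.card_image_of_injOn, hIc]
      intro i hi j hj hij
      have h1 := π.symm.injective hij
      have h2 := add_left_cancel h1
      exact natCast_inj_of_lt n i j ((hI' i hi).1.trans hkn) ((hI' j hj).1.trans hkn) h2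
    · apply cyclNorm_lt_of n _ s hs x
      intro v hv
      simp only [Finset.coe_image, Set.mem_image, Finset.mem_coe] at hv
      obtain ⟨i, hi, rfl⟩ := hv
      exact (hI' i hi).2
    · apply cyclNorm_lt_of n _ k (by omega) y
      intro v hv
      simp only [Finset.coe_image, Set.mem_image, Finset.mem_coe] at hv
      obtain ⟨w, ⟨i, hi, rfl⟩, rfl⟩ := hv
      exact ⟨i, (hI' i hi).1, by simp⟩
  have hg : ∀ x, ∑ y, g x y = s := by
    intro x
    have : ∑ y, g x y = (Finset.univ.filter (fun y => P x y)).card := by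
      rw [Finset.card_filter]
    rw [this]
    have e : Finset.univ.filter (fun y => P x y) =
        (Finset.range s).image (fun i : ℕ => π (x + (i : ZMod n))) := by
      ext y
      simp only [Finset.mem_filter, Finset.mem_univ, true_and, Finset.mem_image, Finset.mem_range, P]
      constructor
      · rintro ⟨i, hi, e⟩
        exact ⟨i, hi, by rw [← e]; simp⟩
      · rintro ⟨i, hi, rfl⟩
        exact ⟨i, hi, by simp⟩
    rw [e, Finset.card_image_of_injOn, Finset.card_range]
    intro i hi j hj hij
    have h2 := add_left_cancel (π.injective hij)
    simp only [Finset.coe_range, Set.mem_Iio] at hi hj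
    exact natCast_inj_of_lt n i j (by omega) (by omega) h2
  have hsum : ∀ x, ∑ y, f x y = s * k := by
    intro x
    simp only [f]
    rw [Finset.sum_comm]
    have : ∀ i ∈ Finset.range k, ∑ y, g x (y + (i : ZMod n)) = s := by
      intro i _
      rw [← hg x]
      exact Equiv.sum_comp (Equiv.addRight (i : ZMod n)) (g x)
    rw [Finset.sum_congr rfl this]
    simp [mul_comm]
  have hle : s * k ≤ r * n := by
    rw [← hsum 0]
    calc ∑ y, f 0 y ≤ ∑ _y : ZMod n, r := Finset.sum_le_sum (fun y _ => hf 0 y)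
      _ = r * n := by simp [ZMod.card, mul_comm]
  refine lt_of_le_of_ne hle (fun heq => ?_)
  have hs' : s < n := by
    by_contra hc
    have : s = n := by omega
    subst this
    nlinarith
  have hfe : ∀ x y, f x y = r := by
    intro x y
    have h1 : ∑ y, f x y = ∑ _y : ZMod n, r := by
      rw [hsum, heq]; simp [ZMod.card, mul_comm]
    exact (Finset.sum_eq_sum_iff_of_le (fun y _ => hf x y)).1 h1 y (Finset.mem_univ _)
  have hshift : ∀ x y, g x (y + (k : ZMod n)) = g x y := by
    intro x y
    have h1 := hfe x y
    have h2 := hfe x (y + 1)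
    have h3 := Finset.sum_range_succ (fun i : ℕ => g x (y + (i : ZMod n))) k
    have h4 := Finset.sum_range_succ' (fun i : ℕ => g x (y + (i : ZMod n))) k
    have h5 : ∑ i ∈ Finset.range k, g x (y + ((i + 1 : ℕ) : ZMod n)) = f x (y + 1) := by
      apply Finset.sum_congr rfl
      intro i _
      congr 1
      push_cast; ring
    rw [h5, h2] at h4
    have h6 : ∑ i ∈ Finset.range k, g x (y + (i : ZMod n)) = r := h1
    rw [h6] at h3
    simp only [Nat.cast_zero, add_zero] at h4
    omega
  have hP : ∀ x y, P x (y + (k : ZMod n)) ↔ P x y := by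
    intro x y
    have := hshift x y
    simp only [g] at this
    by_cases p : P x (y + (k : ZMod n)) <;> by_cases q : P x y <;> simp [p, q] at this ⊢
  have a1 : P 0 (π 0) := ⟨0, hs, by simp⟩
  have a2 : ¬ P 1 (π 0) := by
    rintro ⟨i, hi, e⟩
    simp only [Equiv.symm_apply_apply] at e
    have e2 : ((i + 1 : ℕ) : ZMod n) = ((0 : ℕ) : ZMod n) := by
      push_cast; rw [e]; ring
    have := natCast_inj_of_lt n (i+1) 0 (by omega) (by omega) e2
    omega
  have b1 := (hP 0 (π 0)).2 a1
  have b2 := fun t => a2 ((hP 1 (π 0)).1 t)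
  obtain ⟨i, hi, e⟩ := b1
  rcases Nat.eq_zero_or_pos i with rfl | hi0
  · have e1 : π 0 + (k : ZMod n) = π 0 := by
      rw [Equiv.symm_apply_eq] at e
      simpa using e
    have e2 : (k : ZMod n) = ((0 : ℕ) : ZMod n) := by simpa using e1
    have := natCast_inj_of_lt n k 0 hkn (by omega) e2
    omega
  · apply b2
    refine ⟨i - 1, by omega, ?_⟩
    rw [e]
    obtain ⟨j, rfl⟩ : ∃ j, i = j + 1 := ⟨i - 1, by omega⟩
    simp [add_comm]

/-- level function -/
def lev (d M : ℕ) (j : ℕ) : ℕ := if j < d then j else d - 1 - (j - d) / M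

theorem lev_lt (d M j : ℕ) (hd : 0 < d) : lev d M j < d := by
  unfold lev
  split_ifs
  · assumption
  · exact lt_of_le_of_lt (Nat.sub_le _ _) (by omega)

theorem lev_step (d M j : ℕ) (hd : 0 < d) (hM : 0 < M) :
    lev d M j ≤ lev d M (j + 1) + 1 := by
  unfold lev
  split_ifs with h1 h2 h2
  · omega
  · have : j + 1 - d = 0 := by omega
    rw [this]; simp; omega
  · omega
  · have : (j + 1 - d) / M ≤ (j - d) / M + 1 := by
      rw [← Nat.add_div_right _ hM]
      exact Nat.div_le_div_right (by omega)
    omega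

theorem lev_last (d M : ℕ) (hd : 0 < d) (hM : 0 < M) :
    lev d M ((M + 1) * d - 1) = 0 := by
  have h0 : d ≤ M * d := Nat.le_mul_of_pos_left d hM
  have h1 : (M + 1) * d = M * d + d := by ring
  unfold lev
  rw [if_neg (by omega)]
  have h2 : d - 1 ≤ ((M + 1) * d - 1 - d) / M := by
    rw [Nat.le_div_iff_mul_le hM]
    obtain ⟨e, rfl⟩ : ∃ e, d = e + 1 := ⟨d - 1, by omega⟩
    have : M * (e + 1) = e * M + M := by ring
    simp only [Nat.add_sub_cancel]
    omega
  omega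

theorem lev_inj (d M i j : ℕ) (hd : 0 < d) (hM : 0 < M) (hij : i ≤ j)
    (hj : j < (M + 1) * d) (hl : lev d M i = lev d M j) (hdv : (M + 1) ∣ (j - i)) : i = j := by
  have h1 : (M + 1) * d = M * d + d := by ring
  have key : ∀ t, d ≤ t → t < (M + 1) * d → (t - d) / M < d := by
    intro t _ _
    rw [Nat.div_lt_iff_lt_mul hM, mul_comm]; omega
  unfold lev at hl
  by_cases c1 : i < d
  · by_cases c2 : j < d
    · simpa [c1, c2] using hl
    · exfalso
      simp only [c1, c2, if_true, if_false] at hl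
      have k1 := key j (by omega) hj
      have k2 := Nat.div_add_mod (j - d) M
      have k3 := Nat.mod_lt (j - d) hM
      set q := (j - d) / M
      set u := (j - d) % M
      have : j - i = (M + 1) * q + (1 + u) := by
        have : (M + 1) * q = M * q + q := by ring
        omega
      rw [this] at hdv
      have := (Nat.dvd_add_right (Dvd.intro q rfl)).1 hdv
      have := Nat.le_of_dvd (by omega) this
      omega
  · have c2 : ¬ j < d := by omega
    simp only [c1, c2, if_false] at hl
    have k1 := key j (by omega) hj
    have k1' := key i (by omega) (by omega)
    have k2 := Nat.div_add_mod (j - d) M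
    have k3 := Nat.mod_lt (j - d) hM
    have k2' := Nat.div_add_mod (i - d) M
    have k3' := Nat.mod_lt (i - d) hM
    have e : (i - d) / M = (j - d) / M := by omega
    rw [e] at k2'
    by_contra hne
    have := Nat.le_of_dvd (by omega) hdv
    omega

theorem lower_aux (n k r S : ℕ) (hr : 1 < r) (hkn : k < n) (hrk : r < k)
    (hS : 2 ≤ S) (hSk : S * k < r * n) :
    ∃ π : Equiv.Perm (ZMod n), IsClashFreeR n (S - 1) k r π := by
  haveI : NeZero n := ⟨by omega⟩
  have hSn : S < n := by
    by_contra hc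
    push Not at hc
    have : n * k ≤ S * k := Nat.mul_le_mul_right _ hc
    nlinarith
  obtain ⟨d, hd⟩ : ∃ d, d = Nat.gcd S n := ⟨_, rfl⟩
  have hd0 : 0 < d := by rw [hd]; exact Nat.gcd_pos_of_pos_left _ (by omega)
  have hdS : d ∣ S := hd ▸ Nat.gcd_dvd_left S n
  have hdn : d ∣ n := hd ▸ Nat.gcd_dvd_right S n
  obtain ⟨N, hN⟩ := hdn
  obtain ⟨S', hS'⟩ := hdS
  have hcop : Nat.Coprime S' N := by
    have : Nat.gcd S n = d * Nat.gcd S' N := by rw [hS', hN, Nat.gcd_mul_left]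
    rw [← hd] at this
    exact Nat.eq_of_mul_eq_mul_left hd0 (by rw [← this, mul_one])
  have hN2 : 2 ≤ N := by
    have h0 : 1 ≤ S' := by
      rcases Nat.eq_zero_or_pos S' with rfl | h
      · simp at hS'; omega
      · exact h
    have : d * S' < d * N := by omega
    have := Nat.lt_of_mul_lt_mul_left this
    omega
  obtain ⟨M, rfl⟩ : ∃ M, N = M + 1 := ⟨N - 1, by omega⟩
  have hM : 0 < M := by omega
  have hn' : n = (M + 1) * d := by rw [hN, mul_comm]
  -- slack
  have hslack : S * k + d ≤ r * n := by
    have h1 : S * k = d * (S' * k) := by rw [hS']; ring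
    have h2 : r * n = d * (r * (M + 1)) := by rw [hN]; ring
    rw [h1, h2] at hSk ⊢
    have := Nat.lt_of_mul_lt_mul_left hSk
    calc d * (S' * k) + d = d * (S' * k + 1) := by ring
      _ ≤ _ := Nat.mul_le_mul_left _ this
  let T : ℕ → ℕ := fun j => j * S + lev d M (j % n)
  have hTstep : ∀ j, T j + (S - 1) ≤ T (j + 1) := by
    intro j
    have e : (j + 1) * S = j * S + S := by ring
    simp only [T]
    have hlt := Nat.mod_lt j (show 0 < n by omega)
    have : lev d M (j % n) ≤ lev d M ((j + 1) % n) + 1 := by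
      by_cases hc : j % n = n - 1
      · rw [hc, hn', lev_last d M hd0 hM]; omega
      · have : (j + 1) % n = j % n + 1 := by
          rw [Nat.add_mod, Nat.mod_eq_of_lt (show 1 < n by omega)]
          exact Nat.mod_eq_of_lt (by omega)
        rw [this]; exact lev_step d M _ hd0 hM
    omega
  have hTmono : Monotone T := monotone_nat_of_le_succ (fun j => by have := hTstep j; omega)
  have hTlt : ∀ i j, i < j → T i + (S - 1) ≤ T j :=
    fun i j hij => (hTstep i).trans (hTmono hij)
  have hTcast : ∀ j, ((T (j % n) : ℕ) : ZMod n) = (T j : ZMod n) := by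
    intro j
    simp [T]
  let τ : ZMod n → ZMod n := fun v => ((T v.val : ℕ) : ZMod n)
  have hτ : ∀ j : ℕ, τ (j : ZMod n) = (T j : ZMod n) := by
    intro j
    simp only [τ]
    rw [ZMod.val_natCast, hTcast]
  have hTinj : ∀ i j, i ≤ j → j < n → ((T i : ℕ) : ZMod n) = (T j : ZMod n) → i = j := by
    intro i j hij hj h
    rw [ZMod.natCast_eq_natCast_iff] at h
    have ei : i % n = i := Nat.mod_eq_of_lt (by omega)
    have ej : j % n = j := Nat.mod_eq_of_lt (by omega)
    simp only [T, ei, ej] at h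
    have hmd : lev d M i ≡ lev d M j [MOD d] := by
      have h1 : i * S + lev d M i ≡ j * S + lev d M j [MOD d] := h.of_dvd ⟨M + 1, hN⟩
      have z : ∀ t : ℕ, t * S ≡ 0 [MOD d] := fun t =>
        (Nat.modEq_zero_iff_dvd).2 (Dvd.dvd.mul_left ⟨S', hS'⟩ t)
      have h2 := ((z i).add_right (lev d M i)).symm.trans (h1.trans ((z j).add_right (lev d M j)))
      simpa using h2
    have hl := Nat.ModEq.eq_of_lt_of_lt hmd (lev_lt d M i hd0) (lev_lt d M j hd0)
    rw [hl] at h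
    have h3 := Nat.ModEq.add_right_cancel' _ h
    have h4 := (Nat.modEq_iff_dvd' (Nat.mul_le_mul_right S hij)).1 h3
    rw [← Nat.sub_mul, hN, hS'] at h4
    have h5 : d * (M + 1) ∣ d * ((j - i) * S') := by
      convert h4 using 1; ring
    have h6 := Nat.dvd_of_mul_dvd_mul_left hd0 h5
    have h7 := hcop.symm.dvd_of_dvd_mul_right h6
    exact lev_inj d M i j hd0 hM hij (by omega) hl h7
  have hτinj : Function.Injective τ := by
    intro u v huv
    apply ZMod.val_injective n
    rcases le_total u.val v.val with h | h
    · exact hTinj _ _ h (ZMod.val_lt v) huv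
    · exact (hTinj _ _ h (ZMod.val_lt u) huv.symm).symm
  let e : Equiv.Perm (ZMod n) := Equiv.ofBijective τ (Finite.injective_iff_bijective.1 hτinj)
  refine ⟨e.symm, ?_⟩
  rintro ⟨X, hXc, hX1, hX2⟩
  obtain ⟨x, hx⟩ := cyclNorm_lt_iff n _ _ hX1
  obtain ⟨y, hy⟩ := cyclNorm_lt_iff n _ _ hX2
  -- choose indices
  have hy' : ∀ v : ZMod n, ∃ i : ℕ, v ∈ X → i < k ∧ v = (T (y.val + i) : ZMod n) := by
    intro v
    by_cases hv : v ∈ X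
    · obtain ⟨i, hi, h⟩ := hy (e.symm v) ⟨v, hv, rfl⟩
      refine ⟨i, fun _ => ⟨hi, ?_⟩⟩
      rw [← hτ]
      push_cast
      rw [ZMod.natCast_zmod_val, ← h]
      exact (e.apply_symm_apply v).symm
    · exact ⟨0, fun h => absurd h hv⟩
  choose ι hι using hy'
  let J := X.image ι
  have hJc : J.card = r + 1 := by
    rw [Finset.card_image_of_injOn, hXc]
    intro u hu v hv huv
    rw [(hι u hu).2, (hι v hv).2, huv]
  let D : ℕ → ℤ := fun i => (T (y.val + i) : ℤ) - (x.val : ℤ)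
  have hJ : ∀ i ∈ J, i < k ∧ D i % n < (S : ℤ) - 1 := by
    intro i hi
    obtain ⟨v, hv, rfl⟩ := Finset.mem_image.1 hi
    refine ⟨(hι v hv).1, ?_⟩
    obtain ⟨t, ht, h⟩ := hx v hv
    have h1 : ((D (ι v) : ℤ) : ZMod n) = ((t : ℤ) : ZMod n) := by
      simp only [D]
      push_cast
      rw [← (hι v hv).2, ZMod.natCast_zmod_val, h]; ring
    rw [ZMod.intCast_eq_intCast_iff'] at h1
    rw [h1, Int.emod_eq_of_lt (by omega) (by omega)]
    omega
  have hn0 : (0 : ℤ) < n := by omega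
  have hqlt : ∀ i ∈ J, ∀ j ∈ J, i < j → D i / n < D j / n := by
    intro i hi j hj hij
    have h1 := (hJ i hi).2
    have h2 := (hJ j hj).2
    have h3 := Int.emod_add_mul_ediv (D i) n
    have h4 := Int.emod_add_mul_ediv (D j) n
    have h5 := Int.emod_nonneg (D i) hn0.ne'
    have h6 : D i + (S - 1) ≤ D j := by
      have := hTlt (y.val + i) (y.val + j) (by omega)
      simp only [D]; omega
    by_contra hc
    push Not at hc
    have := mul_le_mul_of_nonneg_left hc hn0.le
    omega
  have hJne : J.Nonempty := Finset.card_pos.1 (by omega)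
  let j0 := J.min' hJne
  have hj0 : j0 ∈ J := J.min'_mem hJne
  have hsub : J.image (fun i => D i / (n : ℤ)) ⊆ Finset.Ico (D j0 / n) (D j0 / n + r) := by
    intro q hq
    obtain ⟨j, hj, rfl⟩ := Finset.mem_image.1 hq
    have hle : j0 ≤ j := J.min'_le j hj
    rw [Finset.mem_Ico]
    constructor
    · rcases hle.eq_or_lt with h | h
      · rw [h]
      · exact (hqlt _ hj0 _ hj h).le
    · have h1 := (hJ j0 hj0).2
      have h3 := Int.emod_add_mul_ediv (D j0) n
      have h4 := Int.emod_add_mul_ediv (D j) n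
      have h5 := Int.emod_nonneg (D j) hn0.ne'
      have hjk := (hJ j hj).1
      have h6 : D j + S + 1 ≤ D j0 + r * n := by
        have a1 := lev_lt d M ((y.val + j) % n) hd0
        have a2 : (y.val + j) * S + S ≤ (y.val + j0) * S + S * k := by
          have : j + 1 ≤ j0 + k := by omega
          have := Nat.mul_le_mul_right S this
          nlinarith
        have a3 : T (y.val + j) + S + 1 ≤ T (y.val + j0) + r * n := by
          simp only [T]; omega
        simp only [D]
        zify at a3
        linarith
      by_contra hc
      push Not at hc
      have := mul_le_mul_of_nonneg_left hc hn0.le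
      nlinarith
  have hcard := Finset.card_le_card hsub
  rw [Finset.card_image_of_injOn, hJc, Int.card_Ico] at hcard
  · simp at hcard
  · intro i hi j hj hij
    rcases lt_trichotomy i j with h | h | h
    · exact absurd hij (hqlt i hi j hj h).ne
    · exact h
    · exact absurd hij (hqlt j hj i hi h).ne'

theorem stmt3 (n k r : ℕ) (hr : 1 < r) (hrk : r < k) (hkn : k < n) :
    (r * n - 1) / k - 1 ≤ sigmaR n k r ∧ sigmaR n k r ≤ (r * n - 1) / k := by
  have hrn : 0 < r * n := Nat.mul_pos (by omega) (by omega)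
  have hk : 0 < k := by omega
  have hup : ∀ s ∈ {s : ℕ | s ≤ n ∧ ∃ π : Equiv.Perm (ZMod n), IsClashFreeR n s k r π},
      s ≤ (r * n - 1) / k := by
    rintro s ⟨hs, π, hπ⟩
    have := upper_aux n k r s hr hrk hkn π hπ hs
    rw [Nat.le_div_iff_mul_le hk]
    omega
  obtain ⟨S, hS⟩ : ∃ S, S = (r * n - 1) / k := ⟨_, rfl⟩
  have hS2 : 2 ≤ S := by
    rw [hS, Nat.le_div_iff_mul_le hk]
    have : 2 * n ≤ r * n := Nat.mul_le_mul_right _ hr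
    omega
  have hSk : S * k < r * n := by
    have : S * k ≤ r * n - 1 := by rw [hS]; exact Nat.div_mul_le_self _ _
    omega
  obtain ⟨π, hπ⟩ := lower_aux n k r S hr hkn hrk hS2 hSk
  have hSn : S < n := by
    by_contra hc
    push Not at hc
    have : n * k ≤ S * k := Nat.mul_le_mul_right _ hc
    nlinarith
  have hmem : S - 1 ∈ {s : ℕ | s ≤ n ∧ ∃ π : Equiv.Perm (ZMod n), IsClashFreeR n s k r π} :=
    ⟨by omega, π, hπ⟩
  constructor
  · rw [← hS]
    exact le_csSup ⟨_, hup⟩ hmem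
  · exact csSup_le ⟨_, hmem⟩ hup
end

section
/- Let r, s, k and n be positive integers with r < k < n and s + 1 < n. Let d = gcd(s+1, n). If k(s+1) + d - 3 ≤ rn - 1, then there exists an (s,k,r)-clash-free permutation of Z_n. -/
/-- lifted inverse permutation -/
def liftP (s m d n j : ℕ) : ℤ := (s + 1) * j - ((j / m : ℕ) : ℤ) + d * ((j / n : ℕ) : ℤ)

lemma liftP_step (s m d n j : ℕ) : liftP s m d n j + s ≤ liftP s m d n (j + 1) := by
  unfold liftP
  have h1 : (j + 1) / m ≤ j / m + 1 := by
    rw [Nat.succ_div]; split_ifs <;> omega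
  have h2 : j / n ≤ (j + 1) / n := Nat.div_le_div_right (by omega)
  have h1' : (((j + 1) / m : ℕ) : ℤ) ≤ ((j / m : ℕ) : ℤ) + 1 := by exact_mod_cast h1
  have h2' : (d : ℤ) * ((j / n : ℕ) : ℤ) ≤ d * (((j + 1) / n : ℕ) : ℤ) :=
    mul_le_mul_of_nonneg_left (by exact_mod_cast h2) (by positivity)
  push_cast at *
  nlinarith

lemma liftP_mono (s m d n : ℕ) : Monotone (liftP s m d n) :=
  monotone_nat_of_le_succ fun j => by
    have := liftP_step s m d n j
    omega

lemma liftP_lt (s m d n i j : ℕ) (h : i < j) : liftP s m d n i + s ≤ liftP s m d n j :=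
  (liftP_step s m d n i).trans (liftP_mono s m d n h)

lemma liftP_upper (s m d n i k : ℕ) (hm : 0 < m) (hd : 0 < d) (hn : n = m * d) (hk : k < n) :
    liftP s m d n (i + k) ≤ liftP s m d n i + (s + 1) * k + (d - 1) := by
  unfold liftP
  have hnpos : 0 < n := by omega
  have h0 : i / m ≤ (i + k) / m := Nat.div_le_div_right (by omega)
  have h1 : (i + k) / n ≤ i / n + 1 := by
    rw [← Nat.add_div_right i hnpos]
    exact Nat.div_le_div_right (by omega)
  have h2 : i / n ≤ (i + k) / n := Nat.div_le_div_right (by omega)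
  have hd' : (1 : ℤ) ≤ d := by exact_mod_cast hd
  rcases Nat.lt_or_ge (i / n) ((i + k) / n) with h | h
  · have e : (i + k) / n = i / n + 1 := by omega
    have h3 : i / m < (i + k) / m := by
      have a1 : i / m < d * (i / n + 1) := by
        rw [Nat.div_lt_iff_lt_mul hm]
        have := Nat.lt_mul_div_succ i hnpos
        calc i < n * (i / n + 1) := this
          _ = d * (i / n + 1) * m := by rw [hn]; ring
      have a2 : d * (i / n + 1) ≤ (i + k) / m := by
        rw [Nat.le_div_iff_mul_le hm]
        have := Nat.mul_div_le (i + k) n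
        calc d * (i / n + 1) * m = n * ((i + k) / n) := by rw [e]; generalize i / n + 1 = w; rw [hn]; ring
          _ ≤ _ := this
      omega
    have h3' : ((i / m : ℕ) : ℤ) + 1 ≤ (((i + k) / m : ℕ) : ℤ) := by exact_mod_cast h3
    rw [e]
    push_cast at *
    nlinarith
  · have e : (i + k) / n = i / n := by omega
    have h3' : ((i / m : ℕ) : ℤ) ≤ (((i + k) / m : ℕ) : ℤ) := by exact_mod_cast h0
    rw [e]
    push_cast at *
    nlinarith

lemma liftP_add (s m d n j : ℕ) (hm : 0 < m) (hd : 0 < d) (hn : n = m * d) :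
    liftP s m d n (j + n) = liftP s m d n j + n * (s + 1) := by
  unfold liftP
  have hnpos : 0 < n := by rw [hn]; positivity
  have h1 : (j + n) / n = j / n + 1 := Nat.add_div_right j hnpos
  have h2 : (j + n) / m = j / m + d := by
    rw [hn]; exact Nat.add_mul_div_left j d hm
  rw [h1, h2]; push_cast; ring

lemma liftP_mod (s m d n j : ℕ) (hm : 0 < m) (hd : 0 < d) (hn : n = m * d) :
    ((liftP s m d n (j % n) : ℤ) : ZMod n) = (liftP s m d n j : ℤ) := by
  have key : ∀ q i, ((liftP s m d n (i + n * q) : ℤ) : ZMod n) = (liftP s m d n i : ℤ) := by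
    intro q
    induction q with
    | zero => intro i; simp
    | succ q ih =>
      intro i
      rw [Nat.mul_succ, ← Nat.add_assoc, liftP_add s m d n _ hm hd hn]
      push_cast
      rw [ih]; simp
  conv_rhs => rw [← Nat.mod_add_div j n]
  rw [key]

lemma liftP_inj (s m d n i j : ℕ) (hm : 0 < m) (hd : 0 < d) (hn : n = m * d)
    (hg : d = Nat.gcd (s + 1) n) (hi : i < n) (hj : j < n)
    (h : ((liftP s m d n i : ℤ) : ZMod n) = (liftP s m d n j : ℤ)) : i = j := by
  rw [ZMod.intCast_eq_intCast_iff_dvd_sub] at h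
  unfold liftP at h
  rw [Nat.div_eq_of_lt hi, Nat.div_eq_of_lt hj] at h
  have hds : (d : ℤ) ∣ (s + 1 : ℤ) := by
    have : d ∣ s + 1 := hg ▸ Nat.gcd_dvd_left _ _
    exact_mod_cast this
  have hdn : (d : ℤ) ∣ n := by exact_mod_cast (⟨m, by rw [hn]; ring⟩ : d ∣ n)
  have hid : i / m < d := by rw [Nat.div_lt_iff_lt_mul hm]; rw [hn] at hi; linarith
  have hjd : j / m < d := by rw [Nat.div_lt_iff_lt_mul hm]; rw [hn] at hj; linarith
  have e : i / m = j / m := by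
    have h1 : (d : ℤ) ∣ ((i / m : ℕ) : ℤ) - ((j / m : ℕ) : ℤ) := by
      have h2 := hdn.trans h
      have h3 : (d : ℤ) ∣ (s + 1) * ((j : ℤ) - i) := Dvd.dvd.mul_right hds _
      have h9 := dvd_sub h2 h3
      generalize i / m = I at *
      generalize j / m = J at *
      have e9 : (I : ℤ) - J = ((s : ℤ) + 1) * j - J + d * ((0 : ℕ) : ℤ) -
        (((s : ℤ) + 1) * i - I + d * ((0 : ℕ) : ℤ)) - (s + 1) * ((j : ℤ) - i) := by
        push_cast; ring
      rw [e9]; exact h9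
    have h4 := Int.eq_zero_of_abs_lt_dvd h1 (by
      clear hg
      generalize i / m = I at *
      generalize j / m = J at *
      rw [abs_lt]; constructor <;> omega)
    omega
  rw [e] at h
  have h5 : (n : ℤ) ∣ (s + 1) * ((j : ℤ) - i) := by
    convert h using 1; push_cast; ring
  have h6 : (m : ℤ) ∣ (j : ℤ) - i := by
    obtain ⟨a, ha⟩ : d ∣ s + 1 := hg ▸ Nat.gcd_dvd_left _ _
    have hcop : Nat.Coprime m a := by
      have : d * 1 = d * Nat.gcd a m := by
        rw [← Nat.gcd_mul_left, ← ha, mul_comm d m, ← hn, ← hg]; simp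
      exact Nat.coprime_comm.mp (Nat.eq_of_mul_eq_mul_left hd this).symm
    have ha' : (s + 1 : ℤ) = d * a := by exact_mod_cast ha
    rw [ha', hn] at h5
    push_cast at h5
    have h7 : (m : ℤ) ∣ a * ((j : ℤ) - i) := by
      have hd0 : (d : ℤ) ≠ 0 := by exact_mod_cast hd.ne'
      apply Int.dvd_of_mul_dvd_mul_left hd0
      convert h5 using 1 <;> ring
    exact (Nat.isCoprime_iff_coprime.mpr hcop).dvd_of_dvd_mul_left h7
  have hi' := Nat.div_add_mod i m
  have hj' := Nat.div_add_mod j m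
  have := Nat.mod_lt i hm
  have := Nat.mod_lt j hm
  rw [e] at hi'
  have h8 := Int.eq_zero_of_abs_lt_dvd h6 (by rw [abs_lt]; constructor <;> omega)
  omega

lemma cyclNorm_spec (n : ℕ) [NeZero n] (X : Set (ZMod n)) (t : ℕ) (h : cyclNorm n X < t) :
    ∃ x : ZMod n, ∀ y ∈ X, ∃ i : ℕ, i < t ∧ y = x + (i : ZMod n) := by
  have hne : {t : ℕ | ∃ x : ZMod n, ∀ y ∈ X, ∃ i : ℕ, i ≤ t ∧ y = x + (i : ZMod n)}.Nonempty :=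
    ⟨n, 0, fun y _ => ⟨y.val, (ZMod.val_lt y).le, by simp⟩⟩
  obtain ⟨x, hx⟩ := Nat.sInf_mem hne
  refine ⟨x, fun y hy => ?_⟩
  obtain ⟨i, hi, e⟩ := hx y hy
  exact ⟨i, lt_of_le_of_lt hi h, e⟩

theorem stmt8 (r s k n : ℕ) (hr : 0 < r) (hs : 0 < s) (hrk : r < k) (hkn : k < n)
    (hsn : s + 1 < n)
    (hbound : k * (s + 1) + Nat.gcd (s + 1) n - 3 ≤ r * n - 1) :
    ∃ π : Equiv.Perm (ZMod n), IsClashFreeR n s k r π := by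
  have : NeZero n := ⟨by omega⟩
  obtain ⟨d, hg⟩ : ∃ d, d = Nat.gcd (s + 1) n := ⟨_, rfl⟩
  rw [← hg] at hbound
  have hd : 0 < d := hg ▸ Nat.gcd_pos_of_pos_left _ (by omega)
  obtain ⟨m, hm'⟩ : d ∣ n := hg ▸ Nat.gcd_dvd_right _ _
  have hn : n = m * d := by rw [hm']; ring
  have hm : 0 < m := by
    rcases Nat.eq_zero_or_pos m with h | h
    · subst h; omega
    · exact h
  have hb : (k : ℤ) * (s + 1) + d ≤ r * n + 2 := by
    have h1 : 2 * 2 ≤ k * (s + 1) := Nat.mul_le_mul (by omega) (by omega)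
    have h2 : 1 * 1 ≤ r * n := Nat.mul_le_mul (by omega) (by omega)
    have : k * (s + 1) + d ≤ r * n + 2 := by omega
    exact_mod_cast this
  let f : ZMod n → ZMod n := fun v => ((liftP s m d n v.val : ℤ) : ZMod n)
  have hf : Function.Injective f := fun a b hab =>
    ZMod.val_injective n (liftP_inj s m d n _ _ hm hd hn hg (ZMod.val_lt a) (ZMod.val_lt b) hab)
  let σ : Equiv.Perm (ZMod n) := Equiv.ofBijective f (Finite.injective_iff_bijective.mp hf)
  have hσ : ∀ j : ℕ, σ (j : ZMod n) = ((liftP s m d n j : ℤ) : ZMod n) := by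
    intro j
    change ((liftP s m d n (j : ZMod n).val : ℤ) : ZMod n) = _
    rw [ZMod.val_natCast, liftP_mod s m d n j hm hd hn]
  refine ⟨σ.symm, ?_⟩
  rintro ⟨X, hX, h1, h2⟩
  obtain ⟨x, hx⟩ := cyclNorm_spec n _ _ h1
  obtain ⟨v, hv⟩ := cyclNorm_spec n _ _ h2
  have key : ∀ y ∈ X, ∃ (q : ℤ) (i j : ℕ), i < s ∧ j < k ∧
      liftP s m d n (v.val + j) = x.val + i + n * q ∧
      y = ((liftP s m d n (v.val + j) : ℤ) : ZMod n) := by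
    intro y hy
    obtain ⟨i, hi, e1⟩ := hx y hy
    obtain ⟨j, hj, e2⟩ := hv (σ.symm y) ⟨y, hy, rfl⟩
    have e3 : y = ((liftP s m d n (v.val + j) : ℤ) : ZMod n) := by
      rw [← hσ]; push_cast
      rw [ZMod.natCast_zmod_val, ← e2]; simp
    have e4 : (((x.val + i : ℤ)) : ZMod n) = ((liftP s m d n (v.val + j) : ℤ) : ZMod n) := by
      rw [← e3, e1]; push_cast; rw [ZMod.natCast_zmod_val]
    rw [ZMod.intCast_eq_intCast_iff_dvd_sub] at e4
    obtain ⟨q, hq⟩ := e4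
    exact ⟨q, i, j, hi, hj, by linarith, e3⟩
  choose! q i j hi hj hP hy using key
  have hqinj : Set.InjOn q X := by
    intro a ha b hb' hab
    have ea := hP a ha
    have eb := hP b hb'
    rw [hab] at ea
    have := hi a ha
    have := hi b hb'
    rcases lt_trichotomy (j a) (j b) with h | h | h
    · have := liftP_lt s m d n (v.val + j a) (v.val + j b) (by omega)
      omega
    · rw [hy a ha, hy b hb', h]
    · have := liftP_lt s m d n (v.val + j b) (v.val + j a) (by omega)
      omega
  obtain ⟨a, ha, hamin⟩ := Finset.exists_min_image X q (Finset.card_pos.mp (by omega))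
  have hsub : X.image q ⊆ Finset.Ico (q a) (q a + r) := by
    intro z hz
    obtain ⟨b, hb', rfl⟩ := Finset.mem_image.mp hz
    rw [Finset.mem_Ico]
    refine ⟨hamin b hb', ?_⟩
    have u1 := liftP_mono s m d n (show v.val ≤ v.val + j a by omega)
    have u2 := liftP_mono s m d n (show v.val + j b ≤ v.val + (k - 1) by have := hj b hb'; omega)
    have u3 := liftP_upper s m d n v.val (k - 1) hm hd hn (by omega)
    rw [hP a ha] at u1
    rw [hP b hb'] at u2
    have := hi a ha
    rw [Nat.cast_sub (by omega)] at u3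
    push_cast at u3
    have hia : (i a : ℤ) + 1 ≤ s := by exact_mod_cast this
    have hib : (0 : ℤ) ≤ i b := by positivity
    have : (n : ℤ) * (q b) < n * (q a + r) := by nlinarith
    exact lt_of_mul_lt_mul_left this (by positivity)
  have hc := Finset.card_le_card hsub
  rw [Finset.card_image_of_injOn hqinj, hX, Int.card_Ico] at hc
  omega
end
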